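/- arXiv:1901.05360 — 3 statements merged into one kernel-verified Lean document; each statement's English description precedes it below -/
import Mathlib

section
/- Fix α ∈ ℂ. Let U ⊆ ℂ \ {0} be an open set on which there exists a holomorphic function s : U → ℂ with s(z)² = z for all z ∈ U (a branch of the square root). Define ξ(z) = [[0, 1/z], [−z + α²/z, 0]] and the gauge g(z) := g₁(z)·g₂(z) where g₁(z) = [[1/s(z), 0], [0, s(z)]] and g₂(z) = [[1, 0], [1/(2z), 1]]. Then for every z ∈ U, g(z) is invertible and the gauged potential satisfies g(z)⁻¹·ξ(z)·g(z) + g(z)⁻¹·g′(z) = [[0, 1], [−1 + (4α² − 1)/(4z²), 0]]. -/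
/-- On an open set `U ⊆ ℂ \ {0}` carrying a holomorphic branch
`s` of the square root (`s(z)² = z`), the gauge `g = g₁·g₂` with
`g₁ = [[1/s, 0], [0, s]]` and `g₂ = [[1, 0], [1/(2z), 1]]` is invertible at each
point and transforms the Bessel potential `ξ(z) = [[0, 1/z], [−z + α²/z, 0]]`
into `g⁻¹ξg + g⁻¹g′ = [[0, 1], [−1 + (4α² − 1)/(4z²), 0]]`. -/
theorem bessel_potential_gauged (α : ℂ) (U : Set ℂ) (hU : IsOpen U)
    (hU0 : ∀ z ∈ U, z ≠ 0)
    (s : ℂ → ℂ) (hs : ∀ z ∈ U, DifferentiableAt ℂ s z)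
    (hs2 : ∀ z ∈ U, s z ^ 2 = z)
    (ξ g g' : ℂ → Matrix (Fin 2) (Fin 2) ℂ)
    (hξ : ∀ z, ξ z = !![0, 1 / z; -z + α ^ 2 / z, 0])
    (hg : ∀ z, g z = !![1 / s z, 0; 0, s z] * !![1, 0; 1 / (2 * z), 1])
    (hg' : ∀ z ∈ U, ∀ i j : Fin 2, HasDerivAt (fun w => g w i j) (g' z i j) z) :
    ∀ z ∈ U, IsUnit (g z) ∧
      (g z)⁻¹ * ξ z * g z + (g z)⁻¹ * g' z =
        !![0, 1; -1 + (4 * α ^ 2 - 1) / (4 * z ^ 2), 0] := by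
  intro z hz
  have hz0 := hU0 z hz
  have h2 := hs2 z hz
  have ht : s z ≠ 0 := by
    intro h
    rw [h] at h2
    exact hz0 (by rw [← h2]; ring)
  have hd := (hs z hz).hasDerivAt
  have hds : deriv s z = 1 / (2 * s z) := by
    have h1 : HasDerivAt (fun w => s w ^ 2) (2 * s z * deriv s z) z := by
      have h := hd.fun_pow 2
      simpa using h
    have h3 : HasDerivAt (fun w => s w ^ 2) 1 z := by
      refine (hasDerivAt_id z).congr_of_eventuallyEq ?_
      filter_upwards [hU.mem_nhds hz] with w hw
      simpa using hs2 w hw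
    have h4 := h1.unique h3
    field_simp
    linear_combination h4
  rw [hds] at hd
  have hinv : HasDerivAt (fun w => 1 / s w) (-(1 / (2 * s z)) / s z ^ 2) z := by
    have h := hd.fun_inv ht
    simpa only [one_div] using h
  have e00 : g' z 0 0 = -1 / (2 * s z ^ 3) := by
    have h := hg' z hz 0 0
    simp only [hg] at h
    have h' : HasDerivAt (fun w => 1 / s w) (g' z 0 0) z := by
      simpa [Matrix.mul_apply, Fin.sum_univ_two] using h
    rw [h'.unique hinv]
    field_simp
  have e01 : g' z 0 1 = 0 := by
    have h := hg' z hz 0 1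
    simp only [hg] at h
    have h' : HasDerivAt (fun w : ℂ => (0 : ℂ)) (g' z 0 1) z := by
      simpa [Matrix.mul_apply, Fin.sum_univ_two] using h
    exact h'.unique (hasDerivAt_const z 0)
  have e11 : g' z 1 1 = 1 / (2 * s z) := by
    have h := hg' z hz 1 1
    simp only [hg] at h
    have h' : HasDerivAt s (g' z 1 1) z := by
      simpa [Matrix.mul_apply, Fin.sum_univ_two] using h
    exact h'.unique hd
  have e10 : g' z 1 0 = -1 / (4 * s z ^ 3) := by
    have h := hg' z hz 1 0
    simp only [hg] at h
    have h' : HasDerivAt (fun w => 1 / s w * (1 / 2)) (g' z 1 0) z := by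
      refine h.congr_of_eventuallyEq ?_
      filter_upwards [hU.mem_nhds hz] with w hw
      have hw2 := hs2 w hw
      have hw0 := hU0 w hw
      have hsw : s w ≠ 0 := by
        intro h
        rw [h] at hw2
        exact hw0 (by rw [← hw2]; ring)
      simp [Matrix.mul_apply, Fin.sum_univ_two]
      field_simp
      linear_combination -hw2
    rw [h'.unique (hinv.mul_const (1 / 2))]
    field_simp
    norm_num
  have eg' : g' z = !![-1 / (2 * s z ^ 3), 0; -1 / (4 * s z ^ 3), 1 / (2 * s z)] := by
    ext i j
    fin_cases i <;> fin_cases j <;> simp [e00, e01, e10, e11]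
  have eg : g z = !![1 / s z, 0; 1 / (2 * s z), s z] := by
    rw [hg]
    ext i j
    fin_cases i <;> fin_cases j <;> simp [Matrix.mul_apply, Fin.sum_univ_two]
    field_simp
    linear_combination h2
  have hdet : (g z).det = 1 := by
    rw [eg, Matrix.det_fin_two_of]
    field_simp
    ring
  have einv : (g z)⁻¹ = !![s z, 0; -1 / (2 * s z), 1 / s z] := by
    apply Matrix.inv_eq_right_inv
    rw [eg]
    ext i j
    fin_cases i <;> fin_cases j <;> simp [Matrix.mul_apply, Fin.sum_univ_two, ht]
    field_simp
    ring
  refine ⟨(Matrix.isUnit_iff_isUnit_det _).2 (by rw [hdet]; exact isUnit_one), ?_⟩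
  rw [einv, eg, eg', hξ]
  generalize s z = t at *
  subst h2
  ext i j
  fin_cases i <;> fin_cases j <;> simp [Matrix.mul_apply, Fin.sum_univ_two] <;> field_simp <;> ring
end

section
/- Let r ∈ ℝ with r < 1, and set a := (1 + √(1 − r))/4 and b := (1 − √(1 − r))/4 (so a + b = 1/2 and a, b ∈ ℝ). Let λ ∈ ℂ with λ ≠ 0 and a + bλ ≠ 0, set t := −(1/4)λ⁻¹(λ − 1)², and let A = [[0, aλ⁻¹ + b], [aλ + b, 0]]. Let U ⊆ ℂ \ {0} be an open set admitting a holomorphic function s : U → ℂ with s(z)² = z, and define the gauge g(z) := g₁(z)·g₂ where g₁(z) = [[s(z), 0], [0, 1/s(z)]] and g₂ = [[1, 0], [−λ/2, a + bλ]]. Then for every z ∈ U, g(z) is invertible and the gauged cylinder potential satisfies exactly g(z)⁻¹·ξ_c(z)·g(z) + g(z)⁻¹·g′(z) = (1/z)·A + [[0, 0], [−λ·z/(a + bλ), 0]], where ξ_c(z) = [[0, λ⁻¹], [λ·Q_t(z), 0]] and Q_t(z) = −(r·t)/(4z²) − 1. In particular the gauged potential has a simple pole at z = 0 with residue the Delaunay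 residue A, and a + b = 1/2. -/
/-- For `r < 1`, `a = (1 + √(1 − r))/4`, `b = (1 − √(1 − r))/4`,
`λ ≠ 0` with `a + bλ ≠ 0` and `t = −(1/4)λ⁻¹(λ − 1)²`, the gauge `g = g₁·g₂` with
`g₁ = [[s, 0], [0, 1/s]]` (for a holomorphic branch `s` of the square root on an
open set `U ⊆ ℂ \ {0}`) and `g₂ = [[1, 0], [−λ/2, a + bλ]]` is invertible and
gauges the cylinder potential `ξ_c(z) = [[0, λ⁻¹], [λ·Q_t(z), 0]]`,
`Q_t(z) = −(r·t)/(4z²) − 1`, exactly into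
`(1/z)·A + [[0, 0], [−λz/(a + bλ), 0]]` with the Delaunay residue
`A = [[0, aλ⁻¹ + b], [aλ + b, 0]]`; moreover `a + b = 1/2`. -/
theorem cylinder_potential_gauged_to_delaunay (r : ℝ) (hr : r < 1)
    (a b : ℝ) (ha : a = (1 + Real.sqrt (1 - r)) / 4)
    (hb : b = (1 - Real.sqrt (1 - r)) / 4)
    (lam : ℂ) (hlam : lam ≠ 0) (habl : (a : ℂ) + b * lam ≠ 0)
    (t : ℂ) (ht : t = -(1 / 4) * lam⁻¹ * (lam - 1) ^ 2)
    (A : Matrix (Fin 2) (Fin 2) ℂ)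
    (hA : A = !![0, a * lam⁻¹ + b; a * lam + b, 0])
    (U : Set ℂ) (hU : IsOpen U) (hU0 : ∀ z ∈ U, z ≠ 0)
    (s : ℂ → ℂ) (hs : ∀ z ∈ U, DifferentiableAt ℂ s z)
    (hs2 : ∀ z ∈ U, s z ^ 2 = z)
    (ξc g g' : ℂ → Matrix (Fin 2) (Fin 2) ℂ)
    (hξ : ∀ z, ξc z = !![0, lam⁻¹; lam * (-((r : ℂ) * t) / (4 * z ^ 2) - 1), 0])
    (hg : ∀ z, g z = !![s z, 0; 0, 1 / s z] * !![1, 0; -lam / 2, (a : ℂ) + b * lam])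
    (hg' : ∀ z ∈ U, ∀ i j : Fin 2, HasDerivAt (fun w => g w i j) (g' z i j) z) :
    a + b = 1 / 2 ∧
    ∀ z ∈ U, IsUnit (g z) ∧
      (g z)⁻¹ * ξc z * g z + (g z)⁻¹ * g' z =
        (1 / z) • A + !![0, 0; -lam * z / ((a : ℂ) + b * lam), 0] := by
  have hab : a + b = 1 / 2 := by rw [ha, hb]; ring
  have hprod : a * b = r / 16 := by
    have h := Real.sq_sqrt (show (0 : ℝ) ≤ 1 - r by linarith)
    rw [ha, hb]; linear_combination (-1 / 16) * h
  have habC : (a : ℂ) + b = 1 / 2 := by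
    have := congrArg (fun x : ℝ => (x : ℂ)) hab
    push_cast at this; exact this
  have hprodC : (r : ℂ) = 16 * (a * b) := by
    have := congrArg (fun x : ℝ => (x : ℂ)) hprod
    push_cast at this; linear_combination (-16) * this
  refine ⟨hab, fun z hz => ?_⟩
  have hz0 := hU0 z hz
  have hsz := hs2 z hz
  have hs0 : s z ≠ 0 := by
    intro h; apply hz0; rw [← hsz, h]; ring
  have hdet : (g z).det = (a : ℂ) + b * lam := by
    rw [hg, Matrix.det_mul, Matrix.det_fin_two_of, Matrix.det_fin_two_of]
    field_simp
    ring
  have hud : IsUnit (g z).det := by rw [hdet]; exact isUnit_iff_ne_zero.mpr habl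
  refine ⟨(Matrix.isUnit_iff_isUnit_det _).mpr hud, ?_⟩
  have hds : HasDerivAt s (1 / (2 * s z)) z := by
    have h1 := (hs z hz).hasDerivAt
    have h2 : HasDerivAt (fun w => s w ^ 2) 1 z := by
      refine (hasDerivAt_id z).congr_of_eventuallyEq ?_
      filter_upwards [hU.mem_nhds hz] with w hw
      exact hs2 w hw
    have h3 := (h1.pow 2).unique h2
    have h4 : deriv s z = 1 / (2 * s z) := by
      rw [eq_div_iff (by simpa using hs0)]
      norm_num at h3
      linear_combination h3
    rwa [h4] at h1
  have hdi : HasDerivAt (fun w => (s w)⁻¹) (-(1 / (2 * s z)) / s z ^ 2) z := hds.inv hs0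
  have hge : ∀ w, g w = !![s w, 0; (s w)⁻¹ * (-lam / 2), (s w)⁻¹ * ((a : ℂ) + b * lam)] := by
    intro w
    rw [hg]
    ext i j
    fin_cases i <;> fin_cases j <;> simp [Matrix.mul_apply, Fin.sum_univ_two]
  have hG : g' z = !![1 / (2 * s z), 0; -(1 / (2 * s z)) / s z ^ 2 * (-lam / 2),
      -(1 / (2 * s z)) / s z ^ 2 * ((a : ℂ) + b * lam)] := by
    have e00 := hg' z hz 0 0
    have e01 := hg' z hz 0 1
    have e10 := hg' z hz 1 0
    have e11 := hg' z hz 1 1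
    simp only [hge] at e00 e01 e10 e11
    ext i j
    fin_cases i <;> fin_cases j
    · exact e00.unique hds
    · exact e01.unique (hasDerivAt_const z (0 : ℂ))
    · exact e10.unique (hdi.mul_const _)
    · exact e11.unique (hdi.mul_const _)
  have key : ξc z * g z + g' z = g z * ((1 / z) • A +
      !![0, 0; -lam * z / ((a : ℂ) + b * lam), 0]) := by
    rw [hG, hge, hξ, hA, ht, hprodC]
    have hb' : (b : ℂ) = 1 / 2 - a := by linear_combination habC
    generalize s z = σ at *
    subst hsz
    ext i j
    fin_cases i <;> fin_cases j <;> simp [Matrix.mul_apply, Fin.sum_univ_two]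
    · field_simp
      ring
    · field_simp
    · obtain ⟨c, hc⟩ : ∃ c : ℂ, c = (a : ℂ) + b * lam := ⟨_, rfl⟩
      rw [← hc] at habl ⊢
      field_simp
      rw [hc, hb']
      ring
    · field_simp
  rw [Matrix.mul_assoc, ← Matrix.mul_add, key, ← Matrix.mul_assoc, Matrix.nonsing_inv_mul _ hud,
    Matrix.one_mul]
end

section
/- Let r ∈ ℝ and for z, λ ∈ ℂ \ {0} define t(λ) := −(1/4)λ⁻¹(λ − 1)², Q(z, λ) := −(r·t(λ))/(4z²) − 1, and the cylinder potential matrix ξ_c(z, λ) := [[0, λ⁻¹], [λ·Q(z, λ), 0]]. Let G(λ) := [[λ⁻¹, 0], [0, λ]]. Then ξ_c satisfies the two reflection symmetries: for all z, λ ∈ ℂ \ {0}, (i) ξ_c(z, 1/λ) equals the entrywise complex conjugate of ξ_c(conj(z), 1/conj(λ)); and (ii) G(λ)⁻¹ · ξ_c(z, λ) · G(λ) equals the entrywise complex conjugate of ξ_c(conj(z), 1/conj(λ)). -/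
open Complex

/-- The cylinder potential
`ξ_c(z, λ) = [[0, λ⁻¹], [λ·Q(z, λ), 0]]` with `Q(z, λ) = −(r·t(λ))/(4z²) − 1`,
`t(λ) = −(1/4)λ⁻¹(λ − 1)²`, satisfies the two reflection symmetries: for all
`z, λ ∈ ℂ \ {0}`, (i) `ξ_c(z, 1/λ)` equals the entrywise conjugate of
`ξ_c(conj z, 1/conj λ)`, and (ii) `G(λ)⁻¹·ξ_c(z, λ)·G(λ)` equals the entrywise
conjugate of `ξ_c(conj z, 1/conj λ)`, where `G(λ) = diag(λ⁻¹, λ)`. -/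
theorem cylinder_potential_reflection_symmetries (r : ℝ)
    (t : ℂ → ℂ) (ht : ∀ lam : ℂ, lam ≠ 0 → t lam = -(1 / 4) * lam⁻¹ * (lam - 1) ^ 2)
    (ξc : ℂ → ℂ → Matrix (Fin 2) (Fin 2) ℂ)
    (hξ : ∀ z lam : ℂ, z ≠ 0 → lam ≠ 0 →
      ξc z lam = !![0, lam⁻¹; lam * (-((r : ℂ) * t lam) / (4 * z ^ 2) - 1), 0])
    (G : ℂ → Matrix (Fin 2) (Fin 2) ℂ)
    (hG : ∀ lam : ℂ, G lam = !![lam⁻¹, 0; 0, lam]) :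
    ∀ z lam : ℂ, z ≠ 0 → lam ≠ 0 →
      ξc z lam⁻¹ = (ξc ((starRingEnd ℂ) z) ((starRingEnd ℂ) lam)⁻¹).map (starRingEnd ℂ) ∧
      (G lam)⁻¹ * ξc z lam * G lam =
        (ξc ((starRingEnd ℂ) z) ((starRingEnd ℂ) lam)⁻¹).map (starRingEnd ℂ) := by
  intro z lam hz hl
  have hz' : (starRingEnd ℂ) z ≠ 0 := by simpa using hz
  have hl' : ((starRingEnd ℂ) lam)⁻¹ ≠ 0 := by simpa using hl
  have hli : lam⁻¹ ≠ 0 := inv_ne_zero hl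
  have h1 : ξc z lam⁻¹ =
      (ξc ((starRingEnd ℂ) z) ((starRingEnd ℂ) lam)⁻¹).map (starRingEnd ℂ) := by
    rw [hξ _ _ hz hli, hξ _ _ hz' hl', ht _ hli, ht _ hl']
    ext i j
    have h4 : (starRingEnd ℂ) 4 = 4 := Complex.conj_ofNat 4
    fin_cases i <;> fin_cases j <;> simp [h4]
  have htt : t lam⁻¹ = t lam := by
    rw [ht _ hli, ht _ hl]
    field_simp
    ring
  have hGi : (G lam)⁻¹ = !![lam, 0; 0, lam⁻¹] := by
    apply Matrix.inv_eq_left_inv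
    rw [hG]
    ext i j
    fin_cases i <;> fin_cases j <;> simp [Matrix.mul_apply, hl]
  refine ⟨h1, ?_⟩
  rw [← h1, hGi, hG, hξ _ _ hz hl, hξ _ _ hz hli, htt]
  ext i j
  fin_cases i <;> fin_cases j <;> simp [Matrix.mul_apply, hl]
  ring
end
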